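/- Let a, b be coprime positive integers and n ≥ 1 an integer. Then ∑_{i=1}^{b−1} ∑_{j=1}^{a−1} (j/a + i/b)^n = ∑_{i=0}^{n−1} C(n,i) S_{a,b}(i)/(ab)^i + (1/(n+1)) · ( B_{n+1}(ab)/(ab)^n − B_{n+1}(a)/a^n − B_{n+1}(b)/b^n − B_{n+1} · (1/(ab)^n − 1/a^n − 1/b^n) ). -/

import Mathlib

/-- The numerical semigroup generated by `a` and `b`. -/
def numSgp (a b : ℕ) : Set ℕ := {n | ∃ i j : ℕ, n = i * a + j * b}

/-- The set of gaps of the numerical semigroup generated by `a` and `b`. -/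
def gaps (a b : ℕ) : Set ℕ := (numSgp a b)ᶜ

/-- The `n`-th Bernoulli polynomial, as a real function:
`B_n(x) = ∑_{i=0}^n C(n,i) B_i x^(n-i)`. -/
noncomputable def bernoulliPoly (n : ℕ) (x : ℝ) : ℝ :=
  ∑ i ∈ Finset.range (n + 1), (n.choose i : ℝ) * (bernoulli i : ℝ) * x ^ (n - i)

/-- The Sylvester sums `S_{a,b}(m) = ∑_{k ∈ C_{a,b}} k^m`. -/
noncomputable def sylvester (a b m : ℕ) : ℝ :=
  ∑ᶠ k ∈ gaps a b, (k : ℝ) ^ m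

/-- Faulhaber's formula in terms of `bernoulliPoly`. -/
theorem bernoulliPoly_succ_natCast (n m : ℕ) :
    bernoulliPoly (n + 1) m
      = bernoulli (n + 1) + (n + 1) * ∑ k ∈ Finset.range m, (k : ℝ) ^ n := by
  have h : ∑ k ∈ Finset.range m, (k : ℝ) ^ n = ∑ i ∈ Finset.range (n + 1),
      (bernoulli i : ℝ) * ((n + 1).choose i : ℝ) * (m : ℝ) ^ (n + 1 - i) / (n + 1) := by
    exact_mod_cast congrArg (Rat.cast : ℚ → ℝ) (sum_range_pow m n)
  have hn : (n : ℝ) + 1 ≠ 0 := by positivity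
  rw [bernoulliPoly, Finset.sum_range_succ, h, Finset.mul_sum, add_comm]
  congr 1
  · simp
  · refine Finset.sum_congr rfl fun i _ => ?_
    field_simp

/-- Points of the box `[0, b) × [0, a)` are determined by the residue of `i * a + j * b`
modulo `a * b`. -/
theorem injOn_mul_add_mul_mod {a b : ℕ} (hab : a.Coprime b) :
    Set.InjOn (fun p : ℕ × ℕ => (p.1 * a + p.2 * b) % (a * b))
      (Finset.range b ×ˢ Finset.range a : Finset (ℕ × ℕ)) := by
  rintro ⟨i, j⟩ hp ⟨i', j'⟩ hq h
  simp only [Finset.coe_product, Finset.coe_range, Set.mem_prod, Set.mem_Iio] at hp hq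
  have h : i * a + j * b ≡ i' * a + j' * b [MOD a * b] := h
  have hj : j * b ≡ j' * b [MOD a] := by
    simpa [Nat.ModEq, Nat.add_mod] using h.of_mul_right b
  have hi : i * a ≡ i' * a [MOD b] := by
    simpa [Nat.ModEq, Nat.add_mod] using h.of_mul_left a
  have hj := hj.cancel_right_of_coprime hab
  have hi := hi.cancel_right_of_coprime hab.symm
  exact Prod.ext (hi.eq_of_lt_of_lt hp.1 hq.1) (hj.eq_of_lt_of_lt hp.2 hq.2)

theorem image_mul_add_mul_mod {a b : ℕ} (ha : 0 < a) (hb : 0 < b) (hab : a.Coprime b) :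
    (Finset.range b ×ˢ Finset.range a).image (fun p => (p.1 * a + p.2 * b) % (a * b))
      = Finset.range (a * b) := by
  refine Finset.eq_of_subset_of_card_le ?_ ?_
  · intro x hx
    obtain ⟨p, -, rfl⟩ := Finset.mem_image.1 hx
    exact Finset.mem_range.2 (Nat.mod_lt _ (Nat.mul_pos ha hb))
  · rw [Finset.card_image_of_injOn (injOn_mul_add_mul_mod hab)]
    simp [mul_comm]

theorem mul_add_mul_lt {a b i j : ℕ} (hi : i < b) (hj : j < a) :
    i * a + j * b < 2 * (a * b) := by
  have h1 : i * a < b * a := Nat.mul_lt_mul_of_pos_right hi (by omega)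
  have h2 : j * b < a * b := Nat.mul_lt_mul_of_pos_right hj (by omega)
  rw [mul_comm b a] at h1
  omega

theorem mem_gaps_of_add_mul_eq {a b i j k : ℕ} (hab : a.Coprime b) (hi : i < b) (hj : j < a)
    (h : k + a * b = i * a + j * b) : k ∈ gaps a b := by
  rintro ⟨i', j', rfl⟩
  have hmod : j * b ≡ j' * b [MOD a] := by
    have : (i' * a + j' * b + a * b) % a = (i * a + j * b) % a := by rw [h]
    simpa [Nat.ModEq, Nat.add_mod] using this.symm
  have hjj : j ≤ j' := by
    have := hmod.cancel_right_of_coprime hab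
    rw [Nat.ModEq, Nat.mod_eq_of_lt hj] at this
    exact this ▸ Nat.mod_le _ _
  have h1 : j * b ≤ j' * b := Nat.mul_le_mul_right b hjj
  have h2 : i * a < b * a := Nat.mul_lt_mul_of_pos_right hi (by omega)
  rw [mul_comm b a] at h2
  omega

theorem gaps_subset_range {a b : ℕ} (ha : 0 < a) (hb : 0 < b) (hab : a.Coprime b) :
    gaps a b ⊆ Finset.range (a * b) := by
  intro k hk
  by_contra hlt
  rw [Finset.mem_coe, Finset.mem_range, not_lt] at hlt
  have hmem : k % (a * b) ∈ Finset.range (a * b) :=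
    Finset.mem_range.2 (Nat.mod_lt _ (Nat.mul_pos ha hb))
  rw [← image_mul_add_mul_mod ha hb hab] at hmem
  obtain ⟨⟨i, j⟩, hp, h⟩ := Finset.mem_image.1 hmem
  simp only [Finset.mem_product, Finset.mem_range] at hp h
  have hx := mul_add_mul_lt hp.1 hp.2
  have hle : i * a + j * b ≤ k := by
    by_contra! hkx
    obtain ⟨c, hc⟩ := (Nat.modEq_iff_dvd' hkx.le).1 (Nat.ModEq.symm h)
    have hc0 : c ≠ 0 := by rintro rfl; omega
    have : a * b ≤ a * b * c := Nat.le_mul_of_pos_right _ (Nat.pos_of_ne_zero hc0)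
    omega
  obtain ⟨c, hc⟩ := (Nat.modEq_iff_dvd' hle).1 h
  refine hk ⟨i + b * c, j, ?_⟩
  have : k = i * a + j * b + a * b * c := by omega
  rw [this]
  ring

open scoped Classical in
/-- The box sums `i * a + j * b` are the non-gaps below `a * b` together with the gaps
translated by `a * b`. -/
theorem sum_box_eq_sum_range {a b : ℕ} (ha : 0 < a) (hb : 0 < b) (hab : a.Coprime b)
    (f : ℕ → ℝ) :
    ∑ i ∈ Finset.range b, ∑ j ∈ Finset.range a, f (i * a + j * b)
      = ∑ k ∈ Finset.range (a * b), if k ∈ gaps a b then f (k + a * b) else f k := by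
  rw [← image_mul_add_mul_mod ha hb hab, Finset.sum_image (injOn_mul_add_mul_mod hab),
    ← Finset.sum_product']
  refine Finset.sum_congr rfl fun ⟨i, j⟩ hp => ?_
  simp only [Finset.mem_product, Finset.mem_range] at hp ⊢
  rcases lt_or_ge (i * a + j * b) (a * b) with hlt | hge
  · rw [Nat.mod_eq_of_lt hlt, if_neg fun h => h ⟨i, j, rfl⟩]
  · have hx := mul_add_mul_lt hp.1 hp.2
    have hmod : (i * a + j * b) % (a * b) = i * a + j * b - a * b := by
      rw [Nat.mod_eq_sub_mod hge, Nat.mod_eq_of_lt (by omega)]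
    have hadd : i * a + j * b - a * b + a * b = i * a + j * b := by omega
    rw [hmod, if_pos (mem_gaps_of_add_mul_eq hab hp.1 hp.2 hadd), hadd]

open scoped Classical in
theorem sylvester_eq_sum {a b : ℕ} (ha : 0 < a) (hb : 0 < b) (hab : a.Coprime b) (m : ℕ) :
    sylvester a b m = ∑ k ∈ Finset.range (a * b) with k ∈ gaps a b, (k : ℝ) ^ m := by
  refine finsum_mem_eq_finite_toFinset_sum _
    ((Finset.finite_toSet _).subset (gaps_subset_range ha hb hab)) |>.trans ?_
  refine Finset.sum_congr ?_ fun _ _ => rfl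
  ext k
  have := @gaps_subset_range a b ha hb hab k
  simp only [Finset.mem_coe, Finset.mem_range] at this
  simpa using this

open scoped Classical in
theorem sum_choose_mul_sylvester {a b : ℕ} (ha : 0 < a) (hb : 0 < b) (hab : a.Coprime b)
    (n : ℕ) :
    ∑ i ∈ Finset.range n, (n.choose i : ℝ) * sylvester a b i * (a * b : ℝ) ^ (n - i)
      = ∑ k ∈ Finset.range (a * b) with k ∈ gaps a b,
          (((k + a * b : ℕ) : ℝ) ^ n - (k : ℝ) ^ n) := by
  simp_rw [sylvester_eq_sum ha hb hab, Finset.mul_sum, Finset.sum_mul]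
  rw [Finset.sum_comm]
  refine Finset.sum_congr rfl fun k _ => ?_
  push_cast
  rw [add_pow, Finset.sum_range_succ]
  simp only [Nat.sub_self, pow_zero, Nat.choose_self, Nat.cast_one, mul_one, add_sub_cancel_right]
  refine Finset.sum_congr rfl fun i _ => ?_
  ring

theorem sum_range_eq_add_sum_Icc (m : ℕ) (hm : 0 < m) (f : ℕ → ℝ) :
    ∑ k ∈ Finset.range m, f k = f 0 + ∑ k ∈ Finset.Icc 1 (m - 1), f k := by
  obtain ⟨m, rfl⟩ := Nat.exists_eq_add_one.2 hm
  rw [Finset.sum_range_eq_add_Ico _ hm]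
  rfl

open scoped Classical in
theorem sum_Icc_mul_add_mul_pow {a b n : ℕ} (ha : 0 < a) (hb : 0 < b) (hab : a.Coprime b)
    (hn : n ≠ 0) :
    ∑ i ∈ Finset.Icc 1 (b - 1), ∑ j ∈ Finset.Icc 1 (a - 1), ((i * a + j * b : ℕ) : ℝ) ^ n
      = ∑ i ∈ Finset.range n, (n.choose i : ℝ) * sylvester a b i * (a * b : ℝ) ^ (n - i)
        + ∑ k ∈ Finset.range (a * b), (k : ℝ) ^ n
        - (b : ℝ) ^ n * ∑ k ∈ Finset.range a, (k : ℝ) ^ n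
        - (a : ℝ) ^ n * ∑ k ∈ Finset.range b, (k : ℝ) ^ n := by
  have hbox := sum_box_eq_sum_range ha hb hab fun k => (k : ℝ) ^ n
  have hgap : (∑ k ∈ Finset.range (a * b),
        if k ∈ gaps a b then ((k + a * b : ℕ) : ℝ) ^ n else (k : ℝ) ^ n)
      = ∑ i ∈ Finset.range n, (n.choose i : ℝ) * sylvester a b i * (a * b : ℝ) ^ (n - i)
        + ∑ k ∈ Finset.range (a * b), (k : ℝ) ^ n := by
    rw [sum_choose_mul_sylvester ha hb hab, Finset.sum_filter, ← Finset.sum_add_distrib]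
    refine Finset.sum_congr rfl fun k _ => ?_
    split_ifs <;> ring
  have hrow (i : ℕ) := sum_range_eq_add_sum_Icc a ha fun j => ((i * a + j * b : ℕ) : ℝ) ^ n
  have hA := sum_range_eq_add_sum_Icc a ha fun k => (k : ℝ) ^ n
  have hB := sum_range_eq_add_sum_Icc b hb fun k => (k : ℝ) ^ n
  rw [hgap] at hbox
  simp_rw [hrow] at hbox
  rw [sum_range_eq_add_sum_Icc b hb, Finset.sum_add_distrib] at hbox
  rw [← hbox, hA, hB]
  simp [hn, mul_pow, Finset.mul_sum, mul_comm]

theorem stmt_15 (a b n : ℕ) (ha : 0 < a) (hb : 0 < b) (hab : Nat.Coprime a b)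
    (hn : 1 ≤ n) :
    ∑ i ∈ Finset.Icc 1 (b - 1), ∑ j ∈ Finset.Icc 1 (a - 1),
        ((j : ℝ) / a + i / b) ^ n
      = (∑ i ∈ Finset.range n, (n.choose i : ℝ) * sylvester a b i / (a * b : ℝ) ^ i)
        + (1 / ((n : ℝ) + 1)) *
          (bernoulliPoly (n + 1) (a * b) / (a * b : ℝ) ^ n
            - bernoulliPoly (n + 1) a / (a : ℝ) ^ n
            - bernoulliPoly (n + 1) b / (b : ℝ) ^ n
            - (bernoulli (n + 1) : ℝ)
                * (1 / (a * b : ℝ) ^ n - 1 / (a : ℝ) ^ n - 1 / (b : ℝ) ^ n)) := by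
  have ha' : (a : ℝ) ≠ 0 := by positivity
  have hb' : (b : ℝ) ≠ 0 := by positivity
  have hn' : (n : ℝ) + 1 ≠ 0 := by positivity
  have hL : ∑ i ∈ Finset.Icc 1 (b - 1), ∑ j ∈ Finset.Icc 1 (a - 1), ((j : ℝ) / a + i / b) ^ n
      = (∑ i ∈ Finset.Icc 1 (b - 1), ∑ j ∈ Finset.Icc 1 (a - 1),
          ((i * a + j * b : ℕ) : ℝ) ^ n) / (a * b : ℝ) ^ n := by
    simp_rw [Finset.sum_div, ← div_pow]
    refine Finset.sum_congr rfl fun i _ => Finset.sum_congr rfl fun j _ => ?_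
    congr 1
    push_cast
    field_simp
    ring
  have hS : ∑ i ∈ Finset.range n, (n.choose i : ℝ) * sylvester a b i / (a * b : ℝ) ^ i
      = (∑ i ∈ Finset.range n, (n.choose i : ℝ) * sylvester a b i * (a * b : ℝ) ^ (n - i))
          / (a * b : ℝ) ^ n := by
    rw [Finset.sum_div]
    refine Finset.sum_congr rfl fun i hi => ?_
    have hab0 : (a * b : ℝ) ≠ 0 := mul_ne_zero ha' hb'
    rw [div_eq_div_iff (pow_ne_zero _ hab0) (pow_ne_zero _ hab0), mul_assoc _ _ (_ ^ i),
      ← pow_add, Nat.sub_add_cancel (Finset.mem_range.1 hi).le]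
  rw [hL, hS, sum_Icc_mul_add_mul_pow ha hb hab (by omega), ← Nat.cast_mul a b,
    bernoulliPoly_succ_natCast, bernoulliPoly_succ_natCast, bernoulliPoly_succ_natCast]
  push_cast
  simp only [mul_pow]
  field_simp
  ring
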